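/- Consider the $L_\infty$ approximation problem ${\rm APP} = \{{\rm APP}_{\infty,d}\}_{d \in \mathbb{N}}$ over the Korobov spaces with exponential weight $H(K_{d,\mathbf{a},\mathbf{b}})$ in the worst case setting, for either information class $\Lambda \in \{\Lambda^{\rm std}, \Lambda^{\rm all}\}$ and either error criterion $\star \in \{{\rm ABS}, {\rm NOR}\}$. Then for $0 < s < 1$ and $0 < t \leq 1$, ${\rm APP}$ is exponentially $(s,t)$-weakly tractable if and only if $\lim_{j \to \infty} \frac{a_j}{j^{(1-s)/s}} = \infty$. -/

import Mathlib

open Filter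
open scoped ENNReal NNReal

noncomputable section

/-- Coefficient space: `ℓ²` sequences indexed by `ℤ^d`.  An element `u` represents the
function `f ∈ H^ω(𝕋^d)` with Fourier coefficients `f̂(k) = u k / ω k`, so that
`‖u‖_{ℓ²} = ‖f‖_{H^ω}`. -/
abbrev Coef (d : ℕ) := lp (fun _ : Fin d → ℤ => ℂ) 2

/-- The periodic function represented by the coefficients `u`:
`f(x) = ∑_{k ∈ ℤ^d} (u k / ω k) e^{2πi k·x}`. -/
def torusFn {d : ℕ} (ω : (Fin d → ℤ) → ℝ) (u : Coef d) (x : Fin d → ℝ) : ℂ :=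
  ∑' k : Fin d → ℤ,
    ((ω k : ℂ))⁻¹ * u k * Complex.exp (2 * Real.pi * Complex.I * ∑ j, (k j : ℂ) * (x j : ℂ))

/-- The torus `𝕋^d`, modelled as the cube `[0,1]^d`. -/
def cube (d : ℕ) : Set (Fin d → ℝ) := {x | ∀ j, x j ∈ Set.Icc (0 : ℝ) 1}

/-- Standard information: point-evaluation functionals `f ↦ f(x)`. -/
def stdInfo {d : ℕ} (ω : (Fin d → ℤ) → ℝ) : Set (Coef d → ℂ) :=
  {L | ∃ x ∈ cube d, L = fun u => torusFn ω u x}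

/-- General linear information: all continuous linear functionals on `H^ω`. -/
def allInfo (d : ℕ) : Set (Coef d → ℂ) := {L | ∃ T : Coef d →L[ℂ] ℂ, L = ⇑T}

/-- The `n`-th minimal worst case error `e(n, APP_{∞,d}; Λ)` of `L_∞`-approximation on the
unit ball of `H^ω(𝕋^d)`, using algorithms `f ↦ φ(L₁ f, …, Lₙ f)` with `Lᵢ ∈ Λ`. -/
def wcErr {d : ℕ} (ω : (Fin d → ℤ) → ℝ) (Λ : Set (Coef d → ℂ)) (n : ℕ) : ℝ≥0∞ :=
  ⨅ (L : Fin n → Coef d → ℂ) (_ : ∀ i, L i ∈ Λ) (φ : (Fin n → ℂ) → (Fin d → ℝ) → ℂ),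
    ⨆ (u : Coef d) (_ : ‖u‖ ≤ 1) (x : Fin d → ℝ) (_ : x ∈ cube d),
      (‖torusFn ω u x - φ (fun i => L i u) x‖₊ : ℝ≥0∞)

/-- The initial error `e(0, APP_{∞,d}) = sup_{‖f‖_{H^ω} ≤ 1} ‖f‖_∞`. -/
def initErr {d : ℕ} (ω : (Fin d → ℤ) → ℝ) : ℝ≥0∞ :=
  ⨆ (u : Coef d) (_ : ‖u‖ ≤ 1) (x : Fin d → ℝ) (_ : x ∈ cube d),
    (‖torusFn ω u x‖₊ : ℝ≥0∞)

/-- The error criterion: absolute (ABS) or normalized (NOR). -/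
inductive Crit | ABS | NOR

/-- `CRI_d`: the normalizing quantity of the error criterion. -/
def CRI {d : ℕ} (ω : (Fin d → ℤ) → ℝ) : Crit → ℝ≥0∞
  | Crit.ABS => 1
  | Crit.NOR => initErr ω

/-- The information complexity `n^⋆(ε, d; Λ)`. -/
def infoComp {d : ℕ} (ω : (Fin d → ℤ) → ℝ) (Λ : Set (Coef d → ℂ)) (crit : Crit) (ε : ℝ) : ℕ :=
  sInf {n : ℕ | wcErr ω Λ n ≤ ENNReal.ofReal ε * CRI ω crit}

/-- Algebraic strong polynomial tractability of the family of information complexities `nc`. -/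
def ALGSPT (nc : ℕ → ℝ → ℕ) : Prop :=
  ∃ C > (0:ℝ), ∃ p ≥ (0:ℝ), ∀ d : ℕ, 0 < d → ∀ ε ∈ Set.Ioo (0:ℝ) 1,
    (nc d ε : ℝ) ≤ C * ε ^ (-p)

/-- The exponent of algebraic strong polynomial tractability. -/
def ALGSPTexp (nc : ℕ → ℝ → ℕ) : ℝ :=
  sInf {p : ℝ | 0 ≤ p ∧ ∃ C > (0:ℝ), ∀ d : ℕ, 0 < d → ∀ ε ∈ Set.Ioo (0:ℝ) 1,
    (nc d ε : ℝ) ≤ C * ε ^ (-p)}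

/-- Algebraic polynomial tractability. -/
def ALGPT (nc : ℕ → ℝ → ℕ) : Prop :=
  ∃ C > (0:ℝ), ∃ p ≥ (0:ℝ), ∃ q ≥ (0:ℝ), ∀ d : ℕ, 0 < d → ∀ ε ∈ Set.Ioo (0:ℝ) 1,
    (nc d ε : ℝ) ≤ C * (d : ℝ) ^ q * ε ^ (-p)

/-- Algebraic quasi-polynomial tractability. -/
def ALGQPT (nc : ℕ → ℝ → ℕ) : Prop :=
  ∃ C > (0:ℝ), ∃ t ≥ (0:ℝ), ∀ d : ℕ, 0 < d → ∀ ε ∈ Set.Ioo (0:ℝ) 1,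
    (nc d ε : ℝ) ≤ C * Real.exp (t * (1 + Real.log d) * (1 + Real.log ε⁻¹))

/-- The exponent of algebraic quasi-polynomial tractability. -/
def ALGQPTexp (nc : ℕ → ℝ → ℕ) : ℝ :=
  sInf {t : ℝ | 0 ≤ t ∧ ∃ C > (0:ℝ), ∀ d : ℕ, 0 < d → ∀ ε ∈ Set.Ioo (0:ℝ) 1,
    (nc d ε : ℝ) ≤ C * Real.exp (t * (1 + Real.log d) * (1 + Real.log ε⁻¹))}

/-- Exponential quasi-polynomial tractability. -/
def EXPQPT (nc : ℕ → ℝ → ℕ) : Prop :=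
  ∃ C > (0:ℝ), ∃ t ≥ (0:ℝ), ∀ d : ℕ, 0 < d → ∀ ε ∈ Set.Ioo (0:ℝ) 1,
    (nc d ε : ℝ) ≤ C * Real.exp (t * (1 + Real.log d) * (1 + Real.log (Real.log ε⁻¹ + 1)))

/-- The exponent of exponential quasi-polynomial tractability. -/
def EXPQPTexp (nc : ℕ → ℝ → ℕ) : ℝ :=
  sInf {t : ℝ | 0 ≤ t ∧ ∃ C > (0:ℝ), ∀ d : ℕ, 0 < d → ∀ ε ∈ Set.Ioo (0:ℝ) 1,
    (nc d ε : ℝ) ≤ C * Real.exp (t * (1 + Real.log d) * (1 + Real.log (Real.log ε⁻¹ + 1)))}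

/-- `lim_{ε⁻¹ + d → ∞} (log nc(d, ε)) / den(d, ε) = 0`. -/
def WTlim (den : ℕ → ℝ → ℝ) (nc : ℕ → ℝ → ℕ) : Prop :=
  ∀ δ > (0:ℝ), ∃ M : ℝ, ∀ d : ℕ, 0 < d → ∀ ε ∈ Set.Ioo (0:ℝ) 1,
    M ≤ ε⁻¹ + d → |Real.log (nc d ε) / den d ε| < δ

/-- Algebraic `(s,t)`-weak tractability; `ALGWTst 1 1` is algebraic weak tractability. -/
def ALGWTst (s t : ℝ) (nc : ℕ → ℝ → ℕ) : Prop :=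
  WTlim (fun d ε => ε ^ (-s) + (d : ℝ) ^ t) nc

/-- Algebraic uniform weak tractability. -/
def ALGUWT (nc : ℕ → ℝ → ℕ) : Prop := ∀ α > (0:ℝ), ∀ β > (0:ℝ), ALGWTst α β nc

/-- Exponential `(s,t)`-weak tractability; `EXPWTst 1 1` is exponential weak tractability. -/
def EXPWTst (s t : ℝ) (nc : ℕ → ℝ → ℕ) : Prop :=
  WTlim (fun d ε => (1 + Real.log ε⁻¹) ^ s + (d : ℝ) ^ t) nc

/-- Exponential uniform weak tractability. -/
def EXPUWT (nc : ℕ → ℝ → ℕ) : Prop := ∀ α > (0:ℝ), ∀ β > (0:ℝ), EXPWTst α β nc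

/-- The weight of the Korobov space with exponential weight `H(K_{d,a,b})`:
`ω_d(h) = ω_h^{-1/2}` where `ω_h = ω^{∑_k a_k |h_k|^{b_k}}` (coordinate `k` uses
`a_{k+1}, b_{k+1}`, the sequences being indexed starting from `1`). -/
def expKorWeight (w : ℝ) (a b : ℕ → ℝ) (d : ℕ) (h : Fin d → ℤ) : ℝ :=
  w ^ (-(∑ j : Fin d, a (j.1 + 1) * (|h j| : ℝ) ^ b (j.1 + 1)) / 2)

/-- The information complexity function of `L_∞`-approximation over the Korobov spaces
with exponential weight, for `Λ^std` (`useStd = true`) or `Λ^all` (`useStd = false`). -/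
def expKorNC (w : ℝ) (a b : ℕ → ℝ) (useStd : Bool) (crit : Crit) : ℕ → ℝ → ℕ := fun d ε =>
  infoComp (expKorWeight w a b d) (if useStd then stdInfo (expKorWeight w a b d) else allInfo d)
    crit ε

def evc {d : ℕ} (k : Fin d → ℤ) (x : Fin d → ℝ) : ℂ :=
  Complex.exp (2 * Real.pi * Complex.I * ∑ j, (k j : ℂ) * (x j : ℂ))

lemma evc_norm {d : ℕ} (k : Fin d → ℤ) (x : Fin d → ℝ) : ‖evc k x‖ = 1 := by
  unfold evc
  have : (2 * Real.pi * Complex.I * ∑ j, (k j : ℂ) * (x j : ℂ))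
      = ((2 * Real.pi * ∑ j, (k j : ℝ) * x j : ℝ) : ℂ) * Complex.I := by
    push_cast; ring
  rw [this, Complex.norm_exp_ofReal_mul_I]

lemma cs_lp {ι : Type*} (F : ι → ℂ) (hF : Summable fun k => ‖F k‖ ^ 2)
    (u : lp (fun _ : ι => ℂ) 2) :
    (Summable fun k => F k * u k) ∧
      ‖∑' k, F k * u k‖ ≤ Real.sqrt (∑' k, ‖F k‖ ^ 2) * ‖u‖ := by
  have hm : Memℓp (fun k => (starRingEnd ℂ) (F k)) 2 := by
    apply memℓp_gen
    simpa using hF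
  let v : lp (fun _ : ι => ℂ) 2 := ⟨_, hm⟩
  have hv : ∀ k, v k = (starRingEnd ℂ) (F k) := fun k => rfl
  have h1 : (fun k => F k * u k) = fun k => inner ℂ (v k) (u k) := by
    funext k
    simp [hv, mul_comm]
  have hn : ‖v‖ = Real.sqrt (∑' k, ‖F k‖ ^ 2) := by
    have := lp.norm_rpow_eq_tsum (p := 2) (by simp) v
    simp only [hv, ENNReal.toReal_ofNat, Real.rpow_ofNat, RCLike.norm_conj] at this
    rw [← this, Real.sqrt_sq (norm_nonneg _)]
  rw [h1]
  refine ⟨lp.summable_inner v u, ?_⟩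
  rw [← lp.inner_eq_tsum, ← hn]
  exact norm_inner_le_norm v u

lemma nn_eq (z : ℂ) : (‖z‖₊ : ℝ≥0∞) = ENNReal.ofReal ‖z‖ := (ofReal_norm z).symm

section gen
variable {d : ℕ} (ω : (Fin d → ℤ) → ℝ)

lemma torusFn_eq (u : Coef d) (x : Fin d → ℝ) :
    torusFn ω u x = ∑' k, ((ω k : ℂ)⁻¹ * evc k x) * u k := by
  unfold torusFn evc
  congr 1; funext k; ring

variable {ω} (hω : ∀ k, 0 < ω k) (hs : Summable fun k => ((ω k)⁻¹) ^ 2)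
include hω

lemma norm_coef (k : Fin d → ℤ) (x : Fin d → ℝ) : ‖(ω k : ℂ)⁻¹ * evc k x‖ = (ω k)⁻¹ := by
  rw [norm_mul, evc_norm, mul_one, norm_inv, Complex.norm_real, Real.norm_of_nonneg (hω k).le]

include hs

lemma torusFn_summable (u : Coef d) (x : Fin d → ℝ) :
    Summable fun k => ((ω k : ℂ)⁻¹ * evc k x) * u k :=
  (cs_lp (fun k => (ω k : ℂ)⁻¹ * evc k x) (by simpa only [norm_coef hω] using hs) u).1

lemma torusFn_bound (u : Coef d) (x : Fin d → ℝ) :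
    ‖torusFn ω u x‖ ≤ Real.sqrt (∑' k, ((ω k)⁻¹) ^ 2) * ‖u‖ := by
  have := (cs_lp (fun k => (ω k : ℂ)⁻¹ * evc k x) (by simpa only [norm_coef hω] using hs) u).2
  rw [torusFn_eq]
  simpa only [norm_coef hω] using this

def torusCLM (x : Fin d → ℝ) : Coef d →L[ℂ] ℂ :=
  LinearMap.mkContinuous
    { toFun := fun u => torusFn ω u x
      map_add' := by
        intro u v
        simp only [torusFn_eq]
        rw [← (torusFn_summable hω hs u x).tsum_add (torusFn_summable hω hs v x)]
        congr 1; funext k; simp [mul_add]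
      map_smul' := by
        intro c u
        simp only [torusFn_eq, RingHom.id_apply, smul_eq_mul]
        rw [← tsum_mul_left]
        congr 1; funext k; simp; ring }
    (Real.sqrt (∑' k, ((ω k)⁻¹) ^ 2)) (fun u => torusFn_bound hω hs u x)

lemma torusCLM_apply (x : Fin d → ℝ) (u : Coef d) : torusCLM hω hs x u = torusFn ω u x := rfl

lemma std_sub_all : stdInfo ω ⊆ allInfo d := by
  rintro L ⟨x, _, rfl⟩
  exact ⟨torusCLM hω hs x, rfl⟩

lemma wcErr_all_le_std (n : ℕ) : wcErr ω (allInfo d) n ≤ wcErr ω (stdInfo ω) n := by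
  unfold wcErr
  refine le_iInf fun L => le_iInf fun hL => ?_
  exact iInf_le_of_le L (iInf_le_of_le (fun i => std_sub_all hω hs (hL i)) le_rfl)

lemma initErr_le : initErr ω ≤ ENNReal.ofReal (Real.sqrt (∑' k, ((ω k)⁻¹) ^ 2)) := by
  unfold initErr
  refine iSup_le fun u => iSup_le fun hu => iSup_le fun x => iSup_le fun _ => ?_
  rw [nn_eq]
  apply ENNReal.ofReal_le_ofReal
  refine (torusFn_bound hω hs u x).trans ?_
  exact mul_le_of_le_one_right (Real.sqrt_nonneg _) hu

lemma torusFn_single (k : Fin d → ℤ) (c : ℂ) (x : Fin d → ℝ) :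
    torusFn ω (lp.single 2 k c) x = (ω k : ℂ)⁻¹ * evc k x * c := by
  classical
  rw [torusFn_eq, tsum_eq_single k]
  · simp
  · intro k' hk'
    simp [hk']

lemma one_le_initErr (h0 : ω 0 = 1) : 1 ≤ initErr ω := by
  classical
  unfold initErr
  refine le_iSup_of_le (lp.single 2 0 1) (le_iSup_of_le (by
    rw [lp.norm_single (by simp)]; simp) (le_iSup_of_le 0 (le_iSup_of_le (by
      intro j; simp) ?_)))
  rw [torusFn_single hω hs, nn_eq]
  rw [norm_mul, norm_coef hω, h0]
  simp

/-- remainder splitting -/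
lemma split (A : Finset (Fin d → ℤ)) (u : Coef d) (hu : ‖u‖ ≤ 1) (τ : ℝ) (hτ : 0 ≤ τ)
    (hA : ∀ B : Finset (Fin d → ℤ), Disjoint A B → ∑ k ∈ B, ((ω k)⁻¹) ^ 2 ≤ τ ^ 2)
    (x : Fin d → ℝ) :
    ‖torusFn ω u x - ∑ k ∈ A, ((ω k : ℂ)⁻¹ * evc k x) * u k‖ ≤ τ := by
  classical
  let F : (Fin d → ℤ) → ℂ := fun k => if k ∈ A then 0 else (ω k : ℂ)⁻¹ * evc k x
  have hF2 : ∀ k, ‖F k‖ ^ 2 = if k ∈ A then 0 else ((ω k)⁻¹) ^ 2 := by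
    intro k
    by_cases hk : k ∈ A
    · simp [F, hk]
    · simp only [F, hk, if_false, norm_coef hω]
  have hFb : ∀ B : Finset (Fin d → ℤ), ∑ k ∈ B, ‖F k‖ ^ 2 ≤ τ ^ 2 := by
    intro B
    refine le_trans (le_of_eq ?_) (hA (B.filter (fun k => k ∉ A)) ?_)
    · rw [Finset.sum_filter]
      refine Finset.sum_congr rfl fun k _ => ?_
      rw [hF2]; by_cases hk : k ∈ A <;> simp [hk]
    · rw [Finset.disjoint_left]
      intro k hk hk'
      simp at hk'
      exact hk'.2 hk
  have hFs : Summable fun k => ‖F k‖ ^ 2 :=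
    summable_of_sum_le (fun k => by positivity) hFb
  obtain ⟨h1, h2⟩ := cs_lp F hFs u
  have h3 : torusFn ω u x = ∑ k ∈ A, ((ω k : ℂ)⁻¹ * evc k x) * u k + ∑' k, F k * u k := by
    rw [torusFn_eq]
    have h4 : HasSum (fun k => if k ∈ A then ((ω k : ℂ)⁻¹ * evc k x) * u k else 0)
        (∑ k ∈ A, ((ω k : ℂ)⁻¹ * evc k x) * u k) := by
      have := hasSum_sum_of_ne_finset_zero (s := A) (L := SummationFilter.unconditional _)
        (f := fun k => if k ∈ A then ((ω k : ℂ)⁻¹ * evc k x) * u k else 0)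
        (by intro k hk; simp [hk])
      convert this using 1
      refine Finset.sum_congr rfl fun k hk => by simp [hk]
    have h5 := h4.add h1.hasSum
    rw [← h5.tsum_eq]
    congr 1; funext k
    by_cases hk : k ∈ A <;> simp [F, hk]
  rw [h3, add_sub_cancel_left]
  refine h2.trans ?_
  have : Real.sqrt (∑' k, ‖F k‖ ^ 2) ≤ τ := by
    rw [Real.sqrt_le_left hτ]
    exact hFs.tsum_le_of_sum_le hFb
  calc _ ≤ τ * 1 := by gcongr
    _ = τ := mul_one _

end gen

section
open scoped Matrix

lemma fekete {N : ℕ} (K : Set (Fin N → ℂ)) (hK : IsCompact K) (hspan : Submodule.span ℂ K = ⊤) :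
    ∃ v : Fin N → (Fin N → ℂ), (∀ i, v i ∈ K) ∧
      ∀ x ∈ K, ∃ c : Fin N → ℂ, (∀ i, ‖c i‖ ≤ 1) ∧ x = ∑ i, c i • v i := by
  classical
  -- a starting independent family
  obtain ⟨B, hBK, hBs, hBli⟩ := exists_linearIndependent ℂ K
  rw [hspan] at hBs
  let bB : Module.Basis B ℂ (Fin N → ℂ) := Module.Basis.mk hBli (by simp [hBs])
  let e : B ≃ Fin N := bB.indexEquiv (Pi.basisFun ℂ (Fin N))
  let v0 : Fin N → (Fin N → ℂ) := fun i => (e.symm i : Fin N → ℂ)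
  have hv0 : LinearIndependent ℂ v0 := hBli.comp _ e.symm.injective
  have hv0K : ∀ i, v0 i ∈ K := fun i => hBK (e.symm i).2
  have hdet0 : (Matrix.of v0).det ≠ 0 := by
    have : IsUnit (Matrix.of v0) := Matrix.linearIndependent_rows_iff_isUnit.mp hv0
    exact ((Matrix.isUnit_iff_isUnit_det _).mp this).ne_zero
  let S : Set (Fin N → Fin N → ℂ) := Set.univ.pi fun _ => K
  have hS : IsCompact S := isCompact_univ_pi fun _ => hK
  have hcont : Continuous fun v : Fin N → Fin N → ℂ => ‖(Matrix.of v)ᵀ.det‖ := by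
    apply Continuous.norm
    apply Continuous.matrix_det
    apply Continuous.matrix_transpose
    exact continuous_id
  obtain ⟨v, hvS, hmax⟩ := hS.exists_isMaxOn ⟨v0, fun i _ => hv0K i⟩ hcont.continuousOn
  have hvK : ∀ i, v i ∈ K := fun i => hvS i trivial
  refine ⟨v, hvK, ?_⟩
  have hdet : 0 < ‖(Matrix.of v)ᵀ.det‖ := by
    have h := hmax (a := v0) (fun i _ => hv0K i)
    simp only [Set.mem_ofPred_eq, Matrix.det_transpose] at h
    rw [Matrix.det_transpose]
    exact (norm_pos_iff.mpr hdet0).trans_le h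
  intro x hx
  set A := (Matrix.of v)ᵀ with hA
  refine ⟨fun i => A.det⁻¹ * A.cramer x i, ?_, ?_⟩
  · intro i
    rw [norm_mul, norm_inv, inv_mul_le_one₀ hdet, Matrix.cramer_apply]
    have h := hmax (a := Function.update v i x) (by
      intro j _
      by_cases hj : j = i
      · subst hj; simpa using hx
      · simpa [hj] using hvK j)
    have h2 : A.updateCol i x = (Matrix.of (Function.update v i x))ᵀ := by
      ext a b
      by_cases hb : b = i
      · subst hb; simp
      · simp [hA, hb]
    rw [h2]
    exact h
  · have h := Matrix.mulVec_cramer A x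
    have hne : A.det ≠ 0 := norm_pos_iff.mp hdet
    have : x = A.det⁻¹ • A.mulVec (A.cramer x) := by
      rw [h, smul_smul, inv_mul_cancel₀ hne, one_smul]
    conv_lhs => rw [this]
    ext j
    simp only [Pi.smul_apply, Matrix.mulVec, dotProduct, hA, Finset.mul_sum, smul_eq_mul, Finset.sum_apply, Matrix.transpose_apply, Matrix.of_apply]
    refine Finset.sum_congr rfl fun i _ => by ring

end

lemma evc_add {d : ℕ} (k : Fin d → ℤ) (x y : Fin d → ℝ) :
    evc k (x + y) = evc k x * evc k y := by
  unfold evc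
  rw [← Complex.exp_add]
  congr 1
  simp only [Pi.add_apply, Complex.ofReal_add, mul_add, Finset.sum_add_distrib]

lemma evc_zero {d : ℕ} (k : Fin d → ℤ) : evc k 0 = 1 := by
  simp [evc]

lemma evc_int {d : ℕ} (k m : Fin d → ℤ) : evc k (fun j => (m j : ℝ)) = 1 := by
  unfold evc
  have := Complex.exp_int_mul_two_pi_mul_I (∑ j, k j * m j)
  rw [← this]
  congr 1
  push_cast
  ring

lemma evc_fract {d : ℕ} (k : Fin d → ℤ) (x : Fin d → ℝ) :
    evc k x = evc k (fun j => Int.fract (x j)) := by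
  have h : x = (fun j => Int.fract (x j)) + fun j => ((⌊x j⌋ : ℤ) : ℝ) := by
    funext j; simp
  conv_lhs => rw [h]
  rw [evc_add, evc_int k (fun j => ⌊x j⌋), mul_one]

def evcHom {d : ℕ} (k : Fin d → ℤ) : Multiplicative (Fin d → ℝ) →* ℂ where
  toFun x := evc k (Multiplicative.toAdd x)
  map_one' := evc_zero k
  map_mul' x y := evc_add k _ _

lemma evcHom_inj {d : ℕ} : Function.Injective (evcHom (d := d)) := by
  intro k l hkl
  by_contra hne
  obtain ⟨j, hj⟩ := Function.ne_iff.mp hne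
  have hj' : ((k j : ℂ) - l j) ≠ 0 := by
    rw [sub_ne_zero]; exact_mod_cast hj
  let x : Fin d → ℝ := Pi.single j (1 / (2 * ((k j : ℝ) - l j)))
  have h1 : evc k x = evc l x := DFunLike.congr_fun hkl (Multiplicative.ofAdd x)
  have hs : ∀ m : Fin d → ℤ, ∑ i, (m i : ℂ) * (x i : ℂ) = m j * (1 / (2 * ((k j : ℂ) - l j))) := by
    intro m
    rw [Finset.sum_eq_single j]
    · simp [x]
    · intro i _ hi; simp [x, hi]
    · simp
  have h2 : evc k x = -evc l x := by
    unfold evc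
    rw [hs, hs, ← neg_one_mul, ← Complex.exp_pi_mul_I, ← Complex.exp_add]
    congr 1
    field_simp
    ring
  have h3 : evc l x ≠ 0 := Complex.exp_ne_zero _
  rw [h1] at h2
  apply h3
  have := add_eq_zero_iff_eq_neg.mpr h2
  rw [← two_mul] at this
  simpa using this

lemma evc_span {d N : ℕ} (hh : Fin N → (Fin d → ℤ)) (hinj : Function.Injective hh) :
    Submodule.span ℂ ((fun x : Fin d → ℝ => fun i => evc (hh i) x) '' cube d) = ⊤ := by
  classical
  by_contra hne
  obtain ⟨f, hf, hle⟩ := Submodule.exists_le_ker_of_lt_top _ (lt_top_iff_ne_top.mpr hne)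
  apply hf
  have key : ∀ x : Fin d → ℝ, ∑ i, evc (hh i) x * f (Pi.single i 1) = 0 := by
    intro x
    have hx : (fun j => Int.fract (x j)) ∈ cube d := by
      intro j
      exact ⟨Int.fract_nonneg _, (Int.fract_lt_one _).le⟩
    have := hle (Submodule.subset_span ⟨_, hx, rfl⟩)
    rw [LinearMap.mem_ker, LinearMap.pi_apply_eq_sum_univ f] at this
    rw [← this]
    refine Finset.sum_congr rfl fun i _ => ?_
    simp only [smul_eq_mul]
    rw [evc_fract (hh i) x]
    congr 2
    funext j
    simp [Pi.single_apply, eq_comm]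
  have hli : LinearIndependent ℂ (fun i : Fin N => ((evcHom (hh i) : Multiplicative (Fin d → ℝ) →* ℂ) : Multiplicative (Fin d → ℝ) → ℂ)) :=
    (linearIndependent_monoidHom (Multiplicative (Fin d → ℝ)) ℂ).comp (fun i => evcHom (hh i))
      (evcHom_inj.comp hinj)
  rw [Fintype.linearIndependent_iff] at hli
  have h0 := hli (fun i => f (Pi.single i 1)) (by
    funext x
    simp only [Finset.sum_apply, Pi.smul_apply, smul_eq_mul, Pi.zero_apply]
    rw [← key (Multiplicative.toAdd x)]
    refine Finset.sum_congr rfl fun i _ => ?_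
    rw [mul_comm]; rfl)
  ext i
  simpa using h0 i

lemma evc_cont {d : ℕ} (k : Fin d → ℤ) : Continuous (evc k) := by
  unfold evc
  fun_prop

lemma cube_compact (d : ℕ) : IsCompact (cube d) := by
  have : cube d = Set.univ.pi fun _ => Set.Icc (0:ℝ) 1 := by
    ext x; simp only [cube, Set.mem_ofPred_eq, Set.mem_pi, Set.mem_univ, true_implies]
  rw [this]
  exact isCompact_univ_pi fun _ => isCompact_Icc

lemma wcErr_std_le {d : ℕ} {ω : (Fin d → ℤ) → ℝ} (hω : ∀ k, 0 < ω k)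
    (hs : Summable fun k => ((ω k)⁻¹) ^ 2) (A : Finset (Fin d → ℤ)) (τ : ℝ) (hτ : 0 ≤ τ)
    (hA : ∀ B : Finset (Fin d → ℤ), Disjoint A B → ∑ k ∈ B, ((ω k)⁻¹) ^ 2 ≤ τ ^ 2) :
    wcErr ω (stdInfo ω) A.card ≤ ENNReal.ofReal ((1 + A.card) * τ) := by
  classical
  let e : Fin A.card ≃ A := A.equivFin.symm
  let hh : Fin A.card → (Fin d → ℤ) := fun i => (e i : Fin d → ℤ)
  have hinj : Function.Injective hh := Subtype.val_injective.comp e.injective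
  obtain ⟨v, hvK, hv⟩ := fekete _ ((cube_compact d).image (f := fun x : Fin d → ℝ => fun i => evc (hh i) x)
    (continuous_pi fun i => evc_cont _)) (evc_span hh hinj)
  choose xs hxs hxv using hvK
  have hv' : ∀ x : Fin d → ℝ, ∃ c : Fin A.card → ℂ, x ∈ cube d → (∀ i, ‖c i‖ ≤ 1) ∧
      ∀ k ∈ A, evc k x = ∑ i, c i * evc k (xs i) := by
    intro x
    by_cases hx : x ∈ cube d
    · obtain ⟨c, hc, hc2⟩ := hv _ ⟨x, hx, rfl⟩
      refine ⟨c, fun _ => ⟨hc, ?_⟩⟩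
      intro k hk
      have := congrFun hc2 (e.symm ⟨k, hk⟩)
      simp only [Finset.sum_apply, Pi.smul_apply, ← hxv, smul_eq_mul, hh, Equiv.apply_symm_apply] at this
      exact this
    · exact ⟨0, fun h => absurd h hx⟩
  choose c hc using hv'
  unfold wcErr
  refine iInf_le_of_le (fun i u => torusFn ω u (xs i)) (iInf_le_of_le
    (fun i => ⟨xs i, hxs i, rfl⟩) (iInf_le_of_le (fun y x => ∑ i, c x i * y i) ?_))
  refine iSup_le fun u => iSup_le fun hu => iSup_le fun x => iSup_le fun hx => ?_
  rw [nn_eq]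
  apply ENNReal.ofReal_le_ofReal
  obtain ⟨hc1, hc2⟩ := hc x hx
  let R : (Fin d → ℝ) → ℂ := fun x => torusFn ω u x - ∑ k ∈ A, ((ω k : ℂ)⁻¹ * evc k x) * u k
  have hR : ∀ x, ‖R x‖ ≤ τ := split hω hs A u hu τ hτ hA
  have hP : ∑ k ∈ A, ((ω k : ℂ)⁻¹ * evc k x) * u k
      = ∑ i, c x i * ∑ k ∈ A, ((ω k : ℂ)⁻¹ * evc k (xs i)) * u k := by
    simp only [Finset.mul_sum]
    rw [Finset.sum_comm]
    refine Finset.sum_congr rfl fun k hk => ?_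
    rw [hc2 k hk, Finset.mul_sum, Finset.sum_mul]
    refine Finset.sum_congr rfl fun i _ => by ring
  have hE : torusFn ω u x - ∑ i, c x i * torusFn ω u (xs i) = R x - ∑ i, c x i * R (xs i) := by
    simp only [R, mul_sub, Finset.sum_sub_distrib]
    rw [← hP]; ring
  rw [hE]
  calc ‖R x - ∑ i, c x i * R (xs i)‖ ≤ ‖R x‖ + ‖∑ i, c x i * R (xs i)‖ := norm_sub_le _ _
    _ ≤ τ + ∑ i : Fin A.card, 1 * τ := by
        gcongr
        · exact hR x
        · refine (norm_sum_le _ _).trans (Finset.sum_le_sum fun i _ => ?_)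
          rw [norm_mul]
          exact mul_le_mul (hc1 i) (hR _) (norm_nonneg _) zero_le_one
    _ = (1 + A.card) * τ := by simp; ring

/-! lower bound -/

def bv {d : ℕ} (β : Fin d → Bool) : Fin d → ℤ := fun j => if β j then 1 else 0
def bx {d : ℕ} (β : Fin d → Bool) : Fin d → ℝ := fun j => if β j then 1 / 2 else 0

lemma bx_mem {d : ℕ} (β : Fin d → Bool) : bx β ∈ cube d := by
  intro j
  by_cases h : β j <;> simp [bx, h]
  norm_num

def sg (p q : Bool) : ℂ := if p && q then -1 else 1

lemma evc_bv {d : ℕ} (β y : Fin d → Bool) : evc (bv β) (bx y) = ∏ j, sg (β j) (y j) := by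
  unfold evc
  rw [Finset.mul_sum, Complex.exp_sum]
  refine Finset.prod_congr rfl fun j _ => ?_
  cases h1 : β j <;> cases h2 : y j <;> simp [bv, bx, sg, h1, h2]
  rw [← Complex.exp_pi_mul_I]
  congr 1
  ring

lemma evc_orth {d : ℕ} (β γ : Fin d → Bool) :
    ∑ y : Fin d → Bool, evc (bv β) (bx y) * evc (bv γ) (bx y) = if β = γ then 2 ^ d else 0 := by
  classical
  simp only [evc_bv, ← Finset.prod_mul_distrib]
  have := Finset.prod_univ_sum (fun _ : Fin d => (Finset.univ : Finset Bool))
    (fun j q => sg (β j) q * sg (γ j) q)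
  rw [Fintype.piFinset_univ] at this
  rw [← this]
  split_ifs with h
  · subst h
    rw [Finset.prod_congr rfl (g := fun _ => (2:ℂ))]
    · simp
    · intro j _
      cases β j <;> simp [sg] <;> norm_num
  · obtain ⟨j, hj⟩ := Function.ne_iff.mp h
    apply Finset.prod_eq_zero (Finset.mem_univ j)
    cases h1 : β j <;> cases h2 : γ j <;> simp_all [sg]

lemma wcErr_all_ge {d : ℕ} {ω : (Fin d → ℤ) → ℝ} (hω : ∀ k, 0 < ω k)
    (hs : Summable fun k => ((ω k)⁻¹) ^ 2) (ρ : ℝ) (hρ : 0 ≤ ρ)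
    (hρ2 : ∀ β : Fin d → Bool, ρ ≤ (ω (bv β))⁻¹) (n : ℕ) (hn : n < 2 ^ d) :
    ENNReal.ofReal (ρ / 2 ^ d) ≤ wcErr ω (allInfo d) n := by
  classical
  unfold wcErr
  refine le_iInf fun L => le_iInf fun hL => le_iInf fun φ => ?_
  choose T hT using hL
  let emb : ((Fin d → Bool) → ℂ) →ₗ[ℂ] Coef d :=
    ∑ β : Fin d → Bool, (lp.lsingle (𝕜 := ℂ) (E := fun _ : Fin d → ℤ => ℂ) 2 (bv β)) ∘ₗ LinearMap.proj β
  have hemb : ∀ c, emb c = ∑ β, lp.single 2 (bv β) (c β) := by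
    intro c
    simp [emb]
  let Φ : ((Fin d → Bool) → ℂ) →ₗ[ℂ] (Fin n → ℂ) :=
    LinearMap.pi fun i => (T i : Coef d →ₗ[ℂ] ℂ) ∘ₗ emb
  have hker : LinearMap.ker Φ ≠ ⊥ := by
    apply LinearMap.ker_ne_bot_of_finrank_lt
    simpa using hn
  obtain ⟨c0, hc0, hc0ne⟩ := Submodule.exists_mem_ne_zero_of_ne_bot hker
  have hσ : 0 < ∑ β, ‖c0 β‖ := by
    obtain ⟨β, hβ⟩ := Function.ne_iff.mp hc0ne
    exact Finset.sum_pos' (fun _ _ => norm_nonneg _) ⟨β, Finset.mem_univ _, norm_pos_iff.mpr hβ⟩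
  set σ := ∑ β, ‖c0 β‖ with hσd
  let c : (Fin d → Bool) → ℂ := ((σ⁻¹ : ℝ) : ℂ) • c0
  have hc : Φ c = 0 := by
    rw [map_smul, LinearMap.mem_ker.mp hc0, smul_zero]
  have hc1 : ∑ β, ‖c β‖ = 1 := by
    simp only [c, Pi.smul_apply, norm_smul, ← Finset.mul_sum]
    rw [← hσd, Complex.norm_real, Real.norm_of_nonneg (by positivity)]
    exact inv_mul_cancel₀ hσ.ne'
  let u := emb c
  have hu : ‖u‖ ≤ 1 := by
    simp only [u, hemb]
    refine (norm_sum_le _ _).trans ?_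
    rw [← hc1]
    refine Finset.sum_le_sum fun β _ => ?_
    rw [lp.norm_single (by simp)]
  have hLu : ∀ i, T i u = 0 := fun i => congrFun hc i
  have hfu : ∀ x, torusFn ω u x = ∑ β, (ω (bv β) : ℂ)⁻¹ * evc (bv β) x * c β := by
    intro x
    rw [← torusCLM_apply hω hs]
    simp only [u, hemb, map_sum]
    refine Finset.sum_congr rfl fun β _ => ?_
    rw [torusCLM_apply, torusFn_single hω hs]
  -- a point where `f` is large
  have hbig : ∃ y : Fin d → Bool, ρ / 2 ^ d ≤ ‖torusFn ω u (bx y)‖ := by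
    by_contra hcon
    push Not at hcon
    have hcoef : ∀ γ : Fin d → Bool, ρ * ‖c γ‖ < ρ / 2 ^ d := by
      intro γ
      have h1 : ∑ y : Fin d → Bool, torusFn ω u (bx y) * evc (bv γ) (bx y)
          = 2 ^ d * ((ω (bv γ) : ℂ)⁻¹ * c γ) := by
        simp only [hfu, Finset.sum_mul]
        rw [Finset.sum_comm]
        have : ∀ β : Fin d → Bool, ∑ y : Fin d → Bool,
            (ω (bv β) : ℂ)⁻¹ * evc (bv β) (bx y) * c β * evc (bv γ) (bx y)
            = (ω (bv β) : ℂ)⁻¹ * c β * (if β = γ then 2 ^ d else 0) := by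
          intro β
          rw [← evc_orth, Finset.mul_sum]
          refine Finset.sum_congr rfl fun y _ => by ring
        simp only [this]
        simp
        ring
      have h2 : ‖∑ y : Fin d → Bool, torusFn ω u (bx y) * evc (bv γ) (bx y)‖
          < ∑ y : Fin d → Bool, ρ / 2 ^ d := by
        refine (norm_sum_le _ _).trans_lt (Finset.sum_lt_sum_of_nonempty Finset.univ_nonempty ?_)
        intro y _
        rw [norm_mul, evc_norm, mul_one]
        exact hcon y
      rw [h1, norm_mul, norm_mul, norm_inv, Complex.norm_real, Real.norm_of_nonneg (hω _).le] at h2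
      simp at h2
      have h3 := mul_le_mul_of_nonneg_right (hρ2 γ) (norm_nonneg (c γ))
      rw [lt_div_iff₀ (by positivity)]
      have h4 : (2:ℝ) ^ d * (ρ / 2 ^ d) = ρ := by field_simp
      have h5 : (0:ℝ) < 2 ^ d := by positivity
      nlinarith
    have h6 : ∑ γ : Fin d → Bool, ρ * ‖c γ‖ < ∑ γ : Fin d → Bool, ρ / 2 ^ d :=
      Finset.sum_lt_sum_of_nonempty Finset.univ_nonempty fun γ _ => hcoef γ
    rw [← Finset.mul_sum, hc1] at h6
    simp at h6
    have h4 : (2:ℝ) ^ d * (ρ / 2 ^ d) = ρ := by field_simp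
    linarith
  obtain ⟨y, hy⟩ := hbig
  set z := φ (fun _ => 0) (bx y) with hz
  have hneg : torusFn ω (-u) (bx y) = - torusFn ω u (bx y) := by
    rw [← torusCLM_apply hω hs, map_neg, torusCLM_apply]
  have hi1 : (fun i => L i u) = fun _ => 0 := by
    funext i; rw [hT]; exact hLu i
  have hi2 : (fun i => L i (-u)) = fun _ => 0 := by
    funext i; rw [hT, map_neg, hLu, neg_zero]
  have htri : ‖torusFn ω u (bx y)‖ ≤ ‖torusFn ω u (bx y) - z‖ ∨
      ‖torusFn ω u (bx y)‖ ≤ ‖-torusFn ω u (bx y) - z‖ := by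
    by_contra hcon
    push Not at hcon
    have : ‖(torusFn ω u (bx y) - z) - (-torusFn ω u (bx y) - z)‖ = 2 * ‖torusFn ω u (bx y)‖ := by
      rw [show (torusFn ω u (bx y) - z) - (-torusFn ω u (bx y) - z) = 2 * torusFn ω u (bx y) by ring]
      simp
    have h2 := norm_sub_le (torusFn ω u (bx y) - z) (-torusFn ω u (bx y) - z)
    linarith [hcon.1, hcon.2]
  rcases htri with h | h
  · refine le_iSup_of_le u (le_iSup_of_le hu (le_iSup_of_le (bx y) (le_iSup_of_le (bx_mem y) ?_)))
    rw [nn_eq, hi1]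
    exact ENNReal.ofReal_le_ofReal (hy.trans h)
  · refine le_iSup_of_le (-u) (le_iSup_of_le (by rwa [norm_neg]) (le_iSup_of_le (bx y) (le_iSup_of_le (bx_mem y) ?_)))
    rw [nn_eq, hi2, hneg]
    exact ENNReal.ofReal_le_ofReal (hy.trans h)

lemma one_dim (c q : ℝ) (hc : 0 < c) (hq : 0 < q) :
    ∃ C > (0:ℝ), ∀ x > (0:ℝ), ∀ β ≥ c, ∀ F : Finset ℤ,
      ∑ h ∈ F, Real.exp (-(x * |(h:ℝ)| ^ β)) ≤ Real.exp (C * min (x ^ (-q)) (x ^ (-(4 * q)))) := by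
  obtain ⟨m, hm⟩ := exists_nat_ge (max (4 * q) (2 / c))
  have hm1 : 4 * q ≤ m := (le_max_left _ _).trans hm
  have hm2 : 2 ≤ c * m := by
    have := (le_max_right _ _).trans hm
    rw [div_le_iff₀ hc] at this; linarith
  have hm0 : 0 ≤ (m:ℝ) := by positivity
  have hZs : Summable fun h : ℤ => 1 / (h:ℝ) ^ 2 := Real.summable_one_div_int_pow.mpr (by norm_num)
  set Z := ∑' h : ℤ, 1 / (h:ℝ) ^ 2
  have hZ : 0 ≤ Z := tsum_nonneg fun h => by positivity
  set B : ℝ := (m.factorial : ℝ) * Z with hB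
  have hB0 : 0 ≤ B := by positivity
  have hlog : 0 ≤ Real.log (1 + B) := Real.log_nonneg (by linarith)
  refine ⟨B + Real.log (1 + B) + m / q + 1, by positivity, ?_⟩
  intro x hx β hβ F
  have h1 : ∑ h ∈ F, Real.exp (-(x * |(h:ℝ)| ^ β)) ≤ 1 + B * (x⁻¹) ^ m := by
    have hterm : ∀ h : ℤ, Real.exp (-(x * |(h:ℝ)| ^ β)) ≤
        (if h = 0 then 1 else 0) + (m.factorial : ℝ) * (x⁻¹) ^ m * (1 / (h:ℝ) ^ 2) := by
      intro h
      by_cases h0 : h = 0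
      · subst h0
        simp only [if_true]
        have : Real.exp (-(x * |((0:ℤ):ℝ)| ^ β)) ≤ 1 := by
          apply Real.exp_le_one_iff.mpr
          have : 0 ≤ x * |((0:ℤ):ℝ)| ^ β := by positivity
          linarith
        simpa using this
      · simp only [h0, if_false, zero_add]
        have habs : 1 ≤ |(h:ℝ)| := by exact_mod_cast Int.one_le_abs h0
        set y := x * |(h:ℝ)| ^ β with hy
        have hypos : 0 < y := by positivity
        have h2 := Real.pow_div_factorial_le_exp y hypos.le m
        rw [Real.exp_neg]
        have h3 : x ^ m * |(h:ℝ)| ^ 2 ≤ y ^ m := by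
          rw [hy, mul_pow]
          gcongr
          rw [← Real.rpow_natCast (|(h:ℝ)| ^ β), ← Real.rpow_mul (by positivity), ← Real.rpow_natCast]
          apply Real.rpow_le_rpow_of_exponent_le habs
          push_cast
          nlinarith
        have h4 : 0 < x ^ m * |(h:ℝ)| ^ 2 / m.factorial := by positivity
        have h5 : x ^ m * |(h:ℝ)| ^ 2 / m.factorial ≤ Real.exp y := by
          refine le_trans ?_ h2
          gcongr
        refine (inv_anti₀ h4 h5).trans (le_of_eq ?_)
        rw [sq_abs, inv_pow]
        field_simp
    refine (Finset.sum_le_sum fun h _ => hterm h).trans ?_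
    rw [Finset.sum_add_distrib, ← Finset.mul_sum]
    have h6 : ∑ h ∈ F, (if h = 0 then (1:ℝ) else 0) ≤ 1 := by
      rw [Finset.sum_ite_eq']; split_ifs <;> norm_num
    have h7 : ∑ h ∈ F, 1 / (h:ℝ) ^ 2 ≤ Z := hZs.sum_le_tsum F (fun h _ => by positivity)
    have h8 : 0 ≤ (m.factorial : ℝ) * (x⁻¹) ^ m := by positivity
    have h9 := mul_le_mul_of_nonneg_left h7 h8
    rw [hB]
    nlinarith
  refine h1.trans ?_
  rw [Real.rpow_neg hx.le, Real.rpow_neg hx.le, ← Real.inv_rpow hx.le, ← Real.inv_rpow hx.le]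
  set y := x⁻¹ with hy
  have hy0 : 0 < y := by positivity
  rcases le_total y 1 with hy1 | hy1
  · have h2 : y ^ (4 * q) ≤ y ^ q := Real.rpow_le_rpow_of_exponent_ge hy0 hy1 (by linarith)
    rw [min_eq_right h2]
    have h3 : y ^ m ≤ y ^ (4 * q) := by
      rw [← Real.rpow_natCast]
      exact Real.rpow_le_rpow_of_exponent_ge hy0 hy1 hm1
    have h4 := Real.add_one_le_exp (B * y ^ m)
    rw [add_comm] at h4
    refine h4.trans (Real.exp_le_exp.mpr ?_)
    have h5 : 0 ≤ (m:ℝ) / q := by positivity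
    apply mul_le_mul _ h3 (by positivity) (by positivity)
    linarith
  · have h2 : y ^ q ≤ y ^ (4 * q) := Real.rpow_le_rpow_of_exponent_le hy1 (by linarith)
    rw [min_eq_left h2]
    have hym : 1 ≤ y ^ m := one_le_pow₀ hy1
    have h3 : 1 + B * y ^ m ≤ (1 + B) * y ^ m := by nlinarith
    refine h3.trans ?_
    rw [← Real.exp_log (show 0 < (1 + B) * y ^ m by positivity)]
    apply Real.exp_le_exp.mpr
    rw [Real.log_mul (by positivity) (by positivity), Real.log_pow]
    have h4 := Real.log_le_rpow_div hy0.le hq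
    have hyq : 1 ≤ y ^ q := Real.one_le_rpow hy1 hq.le
    have h5 := mul_le_mul_of_nonneg_left h4 hm0
    have h6 : (m:ℝ) * (y ^ q / q) = m / q * y ^ q := by ring
    nlinarith

lemma prod_bound {d : ℕ} (f : Fin d → ℤ → ℝ) (hf : ∀ j h, 0 ≤ f j h) (G : Fin d → ℝ)
    (hG : ∀ j, ∀ F : Finset ℤ, ∑ h ∈ F, f j h ≤ G j) (A : Finset (Fin d → ℤ)) :
    ∑ h ∈ A, ∏ j, f j (h j) ≤ ∏ j, G j := by
  classical
  let t : Fin d → Finset ℤ := fun j => A.image fun h => h j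
  calc ∑ h ∈ A, ∏ j, f j (h j) ≤ ∑ h ∈ Fintype.piFinset t, ∏ j, f j (h j) := by
        apply Finset.sum_le_sum_of_subset_of_nonneg
        · intro h hh
          rw [Fintype.mem_piFinset]
          intro j
          exact Finset.mem_image_of_mem _ hh
        · intro h _ _
          exact Finset.prod_nonneg fun j _ => hf _ _
    _ = ∏ j, ∑ h ∈ t j, f j h := (Finset.prod_univ_sum t f).symm
    _ ≤ ∏ j, G j := Finset.prod_le_prod (fun j _ => Finset.sum_nonneg fun h _ => hf _ _) fun j _ => hG _ _

lemma sum_min (R : ℝ) (hR : 0 < R) (d : ℕ) :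
    ∑ k ∈ Finset.range d, min (Real.sqrt (R / ((k:ℝ) + 1))) ((R / ((k:ℝ) + 1)) ^ 2) ≤ 4 * R := by
  set f : ℕ → ℝ := fun k => min (Real.sqrt (R / ((k:ℝ) + 1))) ((R / ((k:ℝ) + 1)) ^ 2)
  have P : ∀ n : ℕ, ∑ k ∈ Finset.range n, f k ≤ 2 * Real.sqrt (R * n) := by
    intro n
    induction n with
    | zero => simp
    | succ n ih =>
      rw [Finset.sum_range_succ]
      have h1 : f n ≤ Real.sqrt (R / ((n:ℝ) + 1)) := min_le_left _ _
      have h2 : Real.sqrt (R / ((n:ℝ) + 1)) ≤ 2 * Real.sqrt (R * (n + 1)) - 2 * Real.sqrt (R * n) := by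
        rw [Real.sqrt_div hR.le, Real.sqrt_mul hR.le, Real.sqrt_mul hR.le]
        set p := Real.sqrt ((n:ℝ) + 1)
        set r := Real.sqrt (n:ℝ)
        have hp : 0 < p := Real.sqrt_pos.mpr (by positivity)
        have hp2 : p ^ 2 = n + 1 := Real.sq_sqrt (by positivity)
        have hr2 : r ^ 2 = n := Real.sq_sqrt (by positivity)
        have hs : 0 ≤ Real.sqrt R := Real.sqrt_nonneg _
        rw [div_le_iff₀ hp]
        have : 1 ≤ (2 * p - 2 * r) * p := by nlinarith [sq_nonneg (p - r)]
        nlinarith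
      push_cast
      linarith
  have Q : ∀ m : ℕ, 1 ≤ m → ∀ n, m ≤ n → ∑ k ∈ Finset.range n, f k ≤
      ∑ k ∈ Finset.range m, f k + R ^ 2 * (1 / m - 1 / n) := by
    intro m hm n hn
    induction n, hn using Nat.le_induction with
    | base => simp
    | succ n hn ih =>
      rw [Finset.sum_range_succ]
      have h1 : f n ≤ (R / ((n:ℝ) + 1)) ^ 2 := min_le_right _ _
      have hn0 : (0:ℝ) < n := by exact_mod_cast (hm.trans hn)
      have h2 : (R / ((n:ℝ) + 1)) ^ 2 ≤ R ^ 2 * (1 / n - 1 / (n + 1)) := by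
        rw [div_pow, div_eq_mul_inv]
        gcongr
        rw [div_sub_div _ _ hn0.ne' (by positivity), ← one_div, div_le_div_iff₀ (by positivity) (by positivity)]
        nlinarith
      push_cast
      have h3 : R ^ 2 * (1 / (m:ℝ) - 1 / n) + R ^ 2 * (1 / n - 1 / (n + 1)) = R ^ 2 * (1 / (m:ℝ) - 1 / (n + 1)) := by ring
      linarith
  rcases lt_or_ge R 1 with h1 | h1
  · rcases Nat.eq_zero_or_pos d with rfl | hd
    · simp; positivity
    · have h2 := Q 1 le_rfl d hd
      have h3 : ∑ k ∈ Finset.range 1, f k ≤ R ^ 2 := by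
        simp only [Finset.sum_range_one]
        refine (min_le_right _ _).trans ?_
        simp
      have h4 : (0:ℝ) ≤ 1 / d := by positivity
      have h5 : R ^ 2 * (1 / ((1:ℕ):ℝ) - 1 / d) ≤ R ^ 2 := by
        push_cast
        nlinarith [sq_nonneg R]
      nlinarith
  · set m := ⌊R⌋₊
    have hm1 : 1 ≤ m := Nat.le_floor (by simpa using h1)
    have hmR : (m:ℝ) ≤ R := Nat.floor_le hR.le
    have hm1' : (1:ℝ) ≤ m := by exact_mod_cast hm1
    have hRm : R ≤ 2 * m := by
      have := Nat.lt_floor_add_one R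
      have h : R < m + 1 := this
      linarith
    have hPm : ∀ n : ℕ, n ≤ m → ∑ k ∈ Finset.range n, f k ≤ 2 * R := by
      intro n hn
      refine (P n).trans ?_
      have hnR : (n:ℝ) ≤ R := le_trans (by exact_mod_cast hn) hmR
      have : Real.sqrt (R * n) ≤ R := by
        rw [Real.sqrt_le_left hR.le]
        nlinarith
      linarith
    rcases le_total d m with hd | hd
    · linarith [hPm d hd]
    · have h2 := Q m hm1 d hd
      have h3 := hPm m le_rfl
      have h4 : (0:ℝ) ≤ 1 / d := by positivity
      have h5 : R ^ 2 * (1 / (m:ℝ) - 1 / d) ≤ R ^ 2 * (1 / (m:ℝ)) := by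
        gcongr; linarith
      have h6 : R ^ 2 * (1 / (m:ℝ)) ≤ 2 * R := by
        rw [mul_one_div, div_le_iff₀ (by linarith)]
        nlinarith
      linarith

lemma key_sum (a : ℕ → ℝ) (a1 p K : ℝ) (ha1 : 0 < a1) (ha : ∀ j, 1 ≤ j → a1 ≤ a j)
    (hp : 0 < p) (hK : 0 < K) (k0 : ℕ) (hk0 : ∀ k, 1 ≤ k → k0 ≤ k → K * (k:ℝ) ^ p ≤ a k)
    (l : ℝ) (hl : 0 < l) (d : ℕ) :
    ∑ j ∈ Finset.range d, min ((l * a (j + 1)) ^ (-(1 / (2 * p)))) ((l * a (j + 1)) ^ (-(4 * (1 / (2 * p)))))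
      ≤ (k0 * a1 ^ (-(1 / (2 * p)))) * l ^ (-(1 / (2 * p))) + 4 * ((l * K) ^ (-(1 / p))) := by
  set q := 1 / (2 * p) with hq
  have hq0 : 0 < q := by positivity
  set R := (l * K) ^ (-(1 / p)) with hRdef
  have hlK : 0 < l * K := by positivity
  have hR : 0 < R := by positivity
  have hterm : ∀ j : ℕ, min ((l * a (j + 1)) ^ (-q)) ((l * a (j + 1)) ^ (-(4 * q))) ≤
      (if j < k0 then (l * a1) ^ (-q) else 0) +
        min (Real.sqrt (R / ((j:ℝ) + 1))) ((R / ((j:ℝ) + 1)) ^ 2) := by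
    intro j
    by_cases hj : j < k0
    · simp only [hj, if_true]
      have h1 : (l * a (j + 1)) ^ (-q) ≤ (l * a1) ^ (-q) := by
        apply Real.rpow_le_rpow_of_nonpos (by positivity) _ (by linarith)
        gcongr
        exact ha _ (by omega)
      have h2 : 0 ≤ min (Real.sqrt (R / ((j:ℝ) + 1))) ((R / ((j:ℝ) + 1)) ^ 2) := by positivity
      linarith [min_le_left ((l * a (j + 1)) ^ (-q)) ((l * a (j + 1)) ^ (-(4 * q)))]
    · simp only [hj, if_false, zero_add]
      have hk := hk0 (j + 1) (by omega) (by omega)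
      push_cast at hk
      have hj1 : (0:ℝ) < (j:ℝ) + 1 := by positivity
      have hle : l * K * ((j:ℝ) + 1) ^ p ≤ l * a (j + 1) := by
        rw [mul_assoc]; gcongr
      have hpos : 0 < l * K * ((j:ℝ) + 1) ^ p := by positivity
      have hgen : ∀ e : ℝ, 0 ≤ e → (l * a (j + 1)) ^ (-(e / p)) ≤ (R / ((j:ℝ) + 1)) ^ e := by
        intro e he
        have h0 : -(e / p) ≤ 0 := by
          have : 0 ≤ e / p := by positivity
          linarith
        refine (Real.rpow_le_rpow_of_nonpos hpos hle h0).trans (le_of_eq ?_)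
        rw [Real.mul_rpow hlK.le (by positivity), Real.div_rpow hR.le hj1.le, hRdef,
          ← Real.rpow_mul hlK.le, ← Real.rpow_mul hj1.le, div_eq_mul_inv (_ ^ _) (_ ^ _), ← Real.rpow_neg hj1.le]
        congr 2 <;> field_simp
      apply min_le_min
      · have := hgen (1/2) (by norm_num)
        rw [← Real.sqrt_eq_rpow] at this
        rwa [show (1:ℝ) / 2 / p = q by rw [hq]; field_simp] at this
      · have := hgen 2 (by norm_num)
        rw [Real.rpow_ofNat] at this
        rwa [show (2:ℝ) / p = 4 * q by rw [hq]; field_simp; norm_num] at this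
  refine (Finset.sum_le_sum fun j _ => hterm j).trans ?_
  rw [Finset.sum_add_distrib]
  have h1 : ∑ j ∈ Finset.range d, (if j < k0 then (l * a1) ^ (-q) else 0) ≤ k0 * (l * a1) ^ (-q) := by
    rw [← Finset.sum_filter, Finset.sum_const, nsmul_eq_mul]
    gcongr
    calc _ ≤ (Finset.range k0).card := Finset.card_le_card (by intro j; simp)
      _ = k0 := by simp
  have h2 := sum_min R hR d
  have h3 : (k0:ℝ) * (l * a1) ^ (-q) = (k0 * a1 ^ (-q)) * l ^ (-q) := by
    rw [Real.mul_rpow hl.le ha1.le]; ring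
  linarith

def EE (a b : ℕ → ℝ) (d : ℕ) (h : Fin d → ℤ) : ℝ :=
  ∑ j : Fin d, a (j.1 + 1) * |(h j : ℝ)| ^ b (j.1 + 1)

lemma wt_pos {w : ℝ} (hw : w ∈ Set.Ioo (0:ℝ) 1) (a b : ℕ → ℝ) (d : ℕ) (h : Fin d → ℤ) :
    0 < expKorWeight w a b d h := Real.rpow_pos_of_pos hw.1 _

lemma wt_inv {w : ℝ} (hw : w ∈ Set.Ioo (0:ℝ) 1) (a b : ℕ → ℝ) (d : ℕ) (h : Fin d → ℤ) :
    (expKorWeight w a b d h)⁻¹ = Real.exp (-((-Real.log w) * EE a b d h / 2)) := by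
  have : expKorWeight w a b d h = w ^ (-(EE a b d h) / 2) := rfl
  rw [this, Real.rpow_def_of_pos hw.1, ← Real.exp_neg]
  congr 1; ring

lemma wt_inv_sq {w : ℝ} (hw : w ∈ Set.Ioo (0:ℝ) 1) (a b : ℕ → ℝ) (d : ℕ) (h : Fin d → ℤ) :
    ((expKorWeight w a b d h)⁻¹) ^ 2 = Real.exp (-((-Real.log w) * EE a b d h)) := by
  rw [wt_inv hw, ← Real.exp_nat_mul]
  congr 1; push_cast; ring

lemma EE_sum (a b : ℕ → ℝ) (C q c : ℝ) (ha : ∀ j, 1 ≤ j → 0 < a j) (hb : ∀ j, 1 ≤ j → c ≤ b j)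
    (hC : ∀ x > (0:ℝ), ∀ β ≥ c, ∀ F : Finset ℤ,
      ∑ h ∈ F, Real.exp (-(x * |(h:ℝ)| ^ β)) ≤ Real.exp (C * min (x ^ (-q)) (x ^ (-(4 * q)))))
    (d : ℕ) (l : ℝ) (hl : 0 < l) (A : Finset (Fin d → ℤ)) :
    ∑ h ∈ A, Real.exp (-(l * EE a b d h)) ≤
      Real.exp (C * ∑ j ∈ Finset.range d,
        min ((l * a (j + 1)) ^ (-q)) ((l * a (j + 1)) ^ (-(4 * q)))) := by
  have h1 : ∀ h : Fin d → ℤ, Real.exp (-(l * EE a b d h)) =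
      ∏ j : Fin d, Real.exp (-((l * a (j.1 + 1)) * |(h j : ℝ)| ^ b (j.1 + 1))) := by
    intro h
    rw [← Real.exp_sum]
    congr 1
    rw [EE, Finset.mul_sum, ← Finset.sum_neg_distrib]
    refine Finset.sum_congr rfl fun j _ => by ring
  simp only [h1]
  refine (prod_bound (fun (j : Fin d) (h : ℤ) =>
    Real.exp (-((l * a (j.1 + 1)) * |(h : ℝ)| ^ b (j.1 + 1)))) (fun _ _ => (Real.exp_pos _).le)
    (fun j => Real.exp (C * min ((l * a (j + 1)) ^ (-q)) ((l * a (j + 1)) ^ (-(4 * q)))))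
    (fun j F => hC _ (mul_pos hl (ha _ (by omega))) _ (hb _ (by omega)) F) A).trans (le_of_eq ?_)
  rw [← Real.exp_sum, Finset.mul_sum, ← Fin.sum_univ_eq_sum_range
    (fun j => C * min ((l * a (j + 1)) ^ (-q)) ((l * a (j + 1)) ^ (-(4 * q))))]

section
variable {w : ℝ} (hw : w ∈ Set.Ioo (0:ℝ) 1) {a b : ℕ → ℝ}
  (ha : ∀ j, 1 ≤ j → 0 < a j)
include hw

lemma L_pos : 0 < -Real.log w := by
  have := Real.log_neg hw.1 hw.2
  linarith

include ha

lemma EE_nonneg (d : ℕ) (h : Fin d → ℤ) : 0 ≤ EE a b d h :=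
  Finset.sum_nonneg fun j _ => mul_nonneg (ha _ (by omega)).le (by positivity)

lemma wt_summable {d : ℕ} {M : ℝ}
    (hM : ∀ A : Finset (Fin d → ℤ), ∑ h ∈ A, Real.exp (-((-Real.log w) / 8 * EE a b d h)) ≤ M) :
    Summable fun k => ((expKorWeight w a b d k)⁻¹) ^ 2 := by
  apply summable_of_sum_le (c := M) (fun k => by positivity)
  intro A
  refine le_trans (Finset.sum_le_sum fun h _ => ?_) (hM A)
  rw [wt_inv_sq hw]
  apply Real.exp_le_exp.mpr
  have := EE_nonneg (b := b) hw ha d h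
  have hL := L_pos hw
  nlinarith [mul_nonneg hL.le this]

lemma upper {d : ℕ} {M : ℝ} (hM1 : 1 ≤ M)
    (hM : ∀ A : Finset (Fin d → ℤ), ∑ h ∈ A, Real.exp (-((-Real.log w) / 8 * EE a b d h)) ≤ M)
    (T : ℝ) (hT : 0 ≤ T) :
    ∃ A : Finset (Fin d → ℤ), (∀ h ∈ A, EE a b d h ≤ T) ∧
      wcErr (expKorWeight w a b d) (stdInfo (expKorWeight w a b d)) A.card ≤
        ENNReal.ofReal (2 * M ^ 2 * Real.exp (-((-Real.log w) / 8 * T))) := by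
  have hL := L_pos hw
  set L := -Real.log w with hLdef
  have hsum : Summable fun h => Real.exp (-(L / 8 * EE a b d h)) :=
    summable_of_sum_le (fun k => (Real.exp_pos _).le) hM
  have hfin : {h : Fin d → ℤ | EE a b d h ≤ T}.Finite := by
    have h1 := hsum.tendsto_cofinite_zero
    have h2 := h1.eventually (gt_mem_nhds (Real.exp_pos (-(L / 8 * T))))
    rw [Filter.eventually_cofinite] at h2
    refine h2.subset ?_
    intro h hh
    simp only [Set.mem_ofPred_eq, not_lt] at hh ⊢
    apply Real.exp_le_exp.mpr
    have : L / 8 * EE a b d h ≤ L / 8 * T := by gcongr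
    linarith
  set A := hfin.toFinset with hA
  have hmem : ∀ h, h ∈ A ↔ EE a b d h ≤ T := by intro h; simp [hA]
  refine ⟨A, fun h hh => (hmem h).mp hh, ?_⟩
  set X := Real.exp (-(L / 8 * T)) with hX
  have hX0 : 0 < X := Real.exp_pos _
  have hX1 : X ≤ 1 := by
    apply Real.exp_le_one_iff.mpr
    have : 0 ≤ L / 8 * T := by positivity
    linarith
  have hcard : A.card * X ≤ M := by
    refine le_trans ?_ (hM A)
    rw [← nsmul_eq_mul, ← Finset.sum_const]
    refine Finset.sum_le_sum fun h hh => ?_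
    apply Real.exp_le_exp.mpr
    have : L / 8 * EE a b d h ≤ L / 8 * T := by
      have := (hmem h).mp hh
      gcongr
    linarith
  have htail : ∀ B : Finset (Fin d → ℤ), Disjoint A B →
      ∑ k ∈ B, ((expKorWeight w a b d k)⁻¹) ^ 2 ≤ (X ^ 2 * M) ^ 2 := by
    intro B hB
    calc ∑ k ∈ B, ((expKorWeight w a b d k)⁻¹) ^ 2
        ≤ ∑ k ∈ B, X ^ 4 * Real.exp (-(L / 8 * EE a b d k)) := by
          refine Finset.sum_le_sum fun k hk => ?_
          rw [wt_inv_sq hw, hX, ← Real.exp_nat_mul, ← Real.exp_add]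
          apply Real.exp_le_exp.mpr
          have hkT : T < EE a b d k := by
            by_contra hcon
            exact Finset.disjoint_left.mp hB ((hmem k).mpr (not_lt.mp hcon)) hk
          push_cast
          rw [← hLdef]
          nlinarith [mul_le_mul_of_nonneg_left hkT.le hL.le, mul_nonneg hL.le hT]
      _ = X ^ 4 * ∑ k ∈ B, Real.exp (-(L / 8 * EE a b d k)) := by rw [Finset.mul_sum]
      _ ≤ X ^ 4 * M := by gcongr; exact hM B
      _ ≤ X ^ 4 * M ^ 2 := by gcongr; nlinarith
      _ = (X ^ 2 * M) ^ 2 := by ring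
  refine (wcErr_std_le (wt_pos hw a b d) (wt_summable hw ha hM) A (X ^ 2 * M) (by positivity) htail).trans ?_
  apply ENNReal.ofReal_le_ofReal
  have h1 : (1 + (A.card:ℝ)) * (X ^ 2 * M) = X ^ 2 * M + (A.card * X) * (X * M) := by ring
  have h2 : (A.card * X) * (X * M) ≤ M * (X * M) := by gcongr
  have h3 : X ^ 2 * M ≤ X * M ^ 2 := by
    have : X * M * X ≤ X * M * M := by gcongr; linarith
    nlinarith
  rw [h1]
  nlinarith

lemma upper_mem {d : ℕ} {M : ℝ} (hM1 : 1 ≤ M)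
    (hM : ∀ A : Finset (Fin d → ℤ), ∑ h ∈ A, Real.exp (-((-Real.log w) / 8 * EE a b d h)) ≤ M)
    (hb : ∀ j, 1 ≤ j → b j ≠ 0)
    (crit : Crit) (useStd : Bool) (ε : ℝ) (hε : ε ∈ Set.Ioo (0:ℝ) 1) :
    ∃ A : Finset (Fin d → ℤ),
      (∀ h ∈ A, EE a b d h ≤ 8 / (-Real.log w) * (Real.log ε⁻¹ + Real.log (2 * M ^ 2))) ∧
      A.card ∈ {n : ℕ | wcErr (expKorWeight w a b d) (if useStd then stdInfo (expKorWeight w a b d) else allInfo d) n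
        ≤ ENNReal.ofReal ε * CRI (expKorWeight w a b d) crit} := by
  have hL := L_pos hw
  have hε0 := hε.1
  have hl1 : 0 ≤ Real.log ε⁻¹ := Real.log_nonneg ((one_le_inv₀ hε0).mpr hε.2.le)
  have hl2 : 0 ≤ Real.log (2 * M ^ 2) := Real.log_nonneg (by nlinarith)
  obtain ⟨A, hA1, hA2⟩ := upper hw ha hM1 hM
    (8 / (-Real.log w) * (Real.log ε⁻¹ + Real.log (2 * M ^ 2))) (by positivity)
  refine ⟨A, hA1, ?_⟩
  have hs := wt_summable hw ha hM
  have hp := wt_pos hw a b d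
  have h0 : expKorWeight w a b d 0 = 1 := by
    have : EE a b d 0 = 0 := by
      apply Finset.sum_eq_zero
      intro j _
      simp [Real.zero_rpow (hb (j.1 + 1) (by omega))]
    have h2 : (expKorWeight w a b d 0)⁻¹ = 1 := by rw [wt_inv hw, this]; simp
    exact inv_eq_one.mp h2
  have hcri : 1 ≤ CRI (expKorWeight w a b d) crit := by
    cases crit
    · exact le_rfl
    · exact one_le_initErr hp hs h0
  have hexp : 2 * M ^ 2 * Real.exp (-((-Real.log w) / 8 * (8 / (-Real.log w) * (Real.log ε⁻¹ + Real.log (2 * M ^ 2))))) = ε := by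
    have h1 : -((-Real.log w) / 8 * (8 / (-Real.log w) * (Real.log ε⁻¹ + Real.log (2 * M ^ 2))))
        = Real.log ε - Real.log (2 * M ^ 2) := by
      have hne : Real.log w ≠ 0 := by intro h; rw [h] at hL; simp at hL
      rw [Real.log_inv]
      field_simp
      ring
    rw [h1, Real.exp_sub, Real.exp_log hε0, Real.exp_log (by positivity)]
    field_simp
  rw [hexp] at hA2
  have hle : ENNReal.ofReal ε ≤ ENNReal.ofReal ε * CRI (expKorWeight w a b d) crit :=
    le_mul_of_one_le_right (by positivity) hcri
  cases useStd
  · exact ((wcErr_all_le_std hp hs _).trans hA2).trans hle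
  · exact hA2.trans hle

lemma lower_le {d : ℕ} {M : ℝ} (hM1 : 1 ≤ M)
    (hM : ∀ A : Finset (Fin d → ℤ), ∑ h ∈ A, Real.exp (-((-Real.log w) / 8 * EE a b d h)) ≤ M)
    (hb : ∀ j, 1 ≤ j → b j ≠ 0) (hmono : ∀ j, j < d → a (j + 1) ≤ a d)
    (crit : Crit) (useStd : Bool) (ε : ℝ) (hε : ε ∈ Set.Ioo (0:ℝ) 1)
    (hεM : ε * M < Real.exp (-((-Real.log w) * (d * a d) / 2)) / 2 ^ d) :
    2 ^ d ≤ expKorNC w a b useStd crit d ε := by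
  have hL := L_pos hw
  have hε0 := hε.1
  have hs := wt_summable hw ha hM
  have hp := wt_pos hw a b d
  obtain ⟨A, -, hA⟩ := upper_mem hw ha hM1 hM hb crit useStd ε hε
  have hmem := Nat.sInf_mem ⟨_, hA⟩
  have heq : expKorNC w a b useStd crit d ε = sInf {n : ℕ | wcErr (expKorWeight w a b d) (if useStd then stdInfo (expKorWeight w a b d) else allInfo d) n
        ≤ ENNReal.ofReal ε * CRI (expKorWeight w a b d) crit} := rfl
  rw [heq]
  set n := sInf {n : ℕ | wcErr (expKorWeight w a b d) (if useStd then stdInfo (expKorWeight w a b d) else allInfo d) n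
        ≤ ENNReal.ofReal ε * CRI (expKorWeight w a b d) crit}
  by_contra hlt
  push Not at hlt
  have hlow := wcErr_all_ge hp hs (Real.exp (-((-Real.log w) * (d * a d) / 2))) (Real.exp_pos _).le
    (by
      intro β
      rw [wt_inv hw]
      apply Real.exp_le_exp.mpr
      have : EE a b d (bv β) ≤ d * a d := by
        unfold EE
        calc _ ≤ ∑ j : Fin d, a d := by
              refine Finset.sum_le_sum fun j _ => ?_
              have h1 := hmono j.1 j.2
              have h2 := ha (j.1 + 1) (by omega)
              cases hβ : β j
              · simp [bv, hβ, Real.zero_rpow (hb (j.1 + 1) (by omega))]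
                linarith
              · simpa [bv, hβ] using h1
          _ = d * a d := by simp
      have := mul_le_mul_of_nonneg_left this hL.le
      linarith) n hlt
  have hcri : CRI (expKorWeight w a b d) crit ≤ ENNReal.ofReal M := by
    cases crit
    · simpa [CRI] using hM1
    · refine (initErr_le hp hs).trans (ENNReal.ofReal_le_ofReal ?_)
      rw [Real.sqrt_le_left (by linarith)]
      refine (hs.tsum_le_of_sum_le (a₂ := M) ?_).trans (by nlinarith)
      intro A
      refine le_trans (Finset.sum_le_sum fun h _ => ?_) (hM A)
      rw [wt_inv_sq hw]
      apply Real.exp_le_exp.mpr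
      have := EE_nonneg (b := b) hw ha d h
      nlinarith [mul_nonneg hL.le this]
  have hall : wcErr (expKorWeight w a b d) (allInfo d) n ≤ ENNReal.ofReal ε * CRI (expKorWeight w a b d) crit := by
    cases useStd
    · exact hmem
    · exact (wcErr_all_le_std hp hs _).trans hmem
  have hfin := (hlow.trans hall).trans (mul_le_mul_right hcri _)
  rw [← ENNReal.ofReal_mul hε0.le, ENNReal.ofReal_le_ofReal_iff (by nlinarith)] at hfin
  linarith

end

set_option maxHeartbeats 2000000 in
lemma suff (w : ℝ) (hw : w ∈ Set.Ioo (0:ℝ) 1) (a b : ℕ → ℝ)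
    (a1 : ℝ) (ha1 : 0 < a1) (ha1' : ∀ j, 1 ≤ j → a1 ≤ a j)
    (c : ℝ) (hc : 0 < c) (hb : ∀ j, 1 ≤ j → c ≤ b j)
    (crit : Crit) (useStd : Bool)
    (s t : ℝ) (hs0 : 0 < s) (hs1 : s < 1) (ht0 : 0 < t)
    (h : Filter.Tendsto (fun j : ℕ => a j / (j : ℝ) ^ ((1 - s) / s)) Filter.atTop Filter.atTop) :
    EXPWTst s t (expKorNC w a b useStd crit) := by
  have hL := L_pos hw
  have ha : ∀ j, 1 ≤ j → 0 < a j := fun j hj => ha1.trans_le (ha1' j hj)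
  have hb0 : ∀ j, 1 ≤ j → b j ≠ 0 := fun j hj => (hc.trans_le (hb j hj)).ne'
  set p := (1 - s) / s with hp
  have hp0 : 0 < p := div_pos (by linarith) hs0
  set q := 1 / (2 * p) with hq
  have hq0 : 0 < q := by positivity
  obtain ⟨C, hC0, hC⟩ := one_dim c q hc hq0
  -- bound on S
  have hS : ∀ K > (0:ℝ), ∃ C1 ≥ (0:ℝ), ∀ (d : ℕ) (l : ℝ), 0 < l → ∀ A : Finset (Fin d → ℤ),
      ∑ h ∈ A, Real.exp (-(l * EE a b d h)) ≤
        Real.exp (C1 * l ^ (-q) + 4 * C * (l * K) ^ (-(1 / p))) := by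
    intro K hK
    obtain ⟨k0, hk0⟩ := Filter.eventually_atTop.mp (Filter.tendsto_atTop.mp h K)
    refine ⟨C * (k0 * a1 ^ (-q)), by positivity, ?_⟩
    intro d l hl A
    refine (EE_sum a b C q c ha hb hC d l hl A).trans (Real.exp_le_exp.mpr ?_)
    have := key_sum a a1 p K ha1 ha1' hp0 hK k0 (by
      intro k hk1 hk2
      have h1 := hk0 k hk2
      rwa [le_div_iff₀ (by have : (0:ℝ) < k := by exact_mod_cast hk1
                           positivity)] at h1) l hl d
    have := mul_le_mul_of_nonneg_left this hC0.le
    rw [← hq] at this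
    refine this.trans (le_of_eq ?_)
    ring
  obtain ⟨C1, hC1, hS1⟩ := hS 1 one_pos
  set L := -Real.log w with hLd
  set M := Real.exp (C1 * (L / 8) ^ (-q) + 4 * C * (L / 8 * 1) ^ (-(1 / p))) with hMd
  have hM1 : 1 ≤ M := Real.one_le_exp (by positivity)
  have hM : ∀ d, ∀ A : Finset (Fin d → ℤ), ∑ h ∈ A, Real.exp (-(L / 8 * EE a b d h)) ≤ M :=
    fun d A => hS1 d (L / 8) (by positivity) A
  have hl2 : 0 ≤ Real.log (2 * M ^ 2) := Real.log_nonneg (by nlinarith)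
  set D := 8 / L * (1 + Real.log (2 * M ^ 2)) with hD
  have hD0 : 0 < D := by positivity
  intro δ hδ
  set η := δ / (4 * D) with hη
  have hη0 : 0 < η := by positivity
  set Y := 16 * C * η ^ (-(1 / p)) / δ with hY
  have hY0 : 0 < Y := by positivity
  obtain ⟨C2, hC2, hS2⟩ := hS (Y ^ p) (by positivity)
  set C3 := (C2 * η ^ (-q)) ^ 2 / δ with hC3
  have hC30 : 0 ≤ C3 := by positivity
  set Q := 4 * C3 / δ + 1 with hQ
  have hQ0 : 0 < Q := by positivity
  refine ⟨2 * max (Q ^ (1 / t)) (Real.exp (Q ^ (1 / s))), ?_⟩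
  intro d hd ε hε hMd2
  have hε0 := hε.1
  have hlε : 0 ≤ Real.log ε⁻¹ := Real.log_nonneg ((one_le_inv₀ hε0).mpr hε.2.le)
  set ℓ := 1 + Real.log ε⁻¹ with hℓ
  have hℓ1 : 1 ≤ ℓ := by linarith
  have hℓ0 : 0 < ℓ := by linarith
  have hd0 : (0:ℝ) < d := by exact_mod_cast hd
  obtain ⟨A, hA1, hA2⟩ := upper_mem hw ha hM1 (hM d) hb0 crit useStd ε hε
  have hn : expKorNC w a b useStd crit d ε ≤ A.card := Nat.sInf_le hA2
  set n := expKorNC w a b useStd crit d ε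
  have hT : ∀ h ∈ A, EE a b d h ≤ D * ℓ := by
    intro h hh
    refine (hA1 h hh).trans ?_
    rw [hD, mul_assoc]
    gcongr
    nlinarith
  set l := η * ℓ ^ (s - 1) with hl
  have hl0 : 0 < l := by positivity
  have hℓs : 0 < ℓ ^ s := by positivity
  -- cardinality
  have hcard : (A.card : ℝ) ≤ Real.exp (l * (D * ℓ) + (C2 * l ^ (-q) + 4 * C * (l * Y ^ p) ^ (-(1 / p)))) := by
    have h1 : (A.card : ℝ) * Real.exp (-(l * (D * ℓ))) ≤
        Real.exp (C2 * l ^ (-q) + 4 * C * (l * Y ^ p) ^ (-(1 / p))) := by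
      refine le_trans ?_ (hS2 d l hl0 A)
      rw [← nsmul_eq_mul, ← Finset.sum_const]
      refine Finset.sum_le_sum fun h hh => ?_
      apply Real.exp_le_exp.mpr
      have := mul_le_mul_of_nonneg_left (hT h hh) hl0.le
      linarith
    rw [Real.exp_add, ← div_le_iff₀' (Real.exp_pos _), div_eq_mul_inv, ← Real.exp_neg]
    exact h1
  have e1 : l * (D * ℓ) = δ / 4 * ℓ ^ s := by
    have : ℓ ^ s = ℓ ^ (s - 1) * ℓ := by
      rw [← Real.rpow_add_one hℓ0.ne']; congr 1; ring
    rw [hl, this, hη]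
    field_simp
  have e2 : l ^ (-q) = η ^ (-q) * ℓ ^ (s / 2) := by
    rw [hl, Real.mul_rpow hη0.le (by positivity), ← Real.rpow_mul hℓ0.le]
    congr 2
    have : (1 - s) ≠ 0 := by linarith
    rw [hq, hp]; field_simp; ring
  have e3 : 4 * C * (l * Y ^ p) ^ (-(1 / p)) = δ / 4 * ℓ ^ s := by
    have h1 : (Y ^ p) ^ (-(1 / p)) = Y⁻¹ := by
      rw [← Real.rpow_mul hY0.le, ← Real.rpow_neg_one]
      congr 1; field_simp
    have h2 : (ℓ ^ (s - 1)) ^ (-(1 / p)) = ℓ ^ s := by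
      rw [← Real.rpow_mul hℓ0.le]
      congr 1
      have : (1 - s) ≠ 0 := by linarith
      rw [hp]; field_simp; ring
    rw [hl, Real.mul_rpow (by positivity) (by positivity), Real.mul_rpow hη0.le (by positivity), h1, h2, hY]
    have : 0 < η ^ (-(1 / p)) := by positivity
    field_simp
    norm_num
  have hlogn : Real.log n ≤ 3 * δ / 4 * ℓ ^ s + C3 := by
    rw [e1, e2, e3] at hcard
    rcases Nat.eq_zero_or_pos n with h0 | h0
    · rw [h0]; simp; positivity
    · have hn0 : (0:ℝ) < n := by exact_mod_cast h0
      have h1 : (n:ℝ) ≤ A.card := by exact_mod_cast hn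
      have h2 := Real.log_le_log hn0 (h1.trans hcard)
      rw [Real.log_exp] at h2
      have hy : ℓ ^ s = (ℓ ^ (s / 2)) ^ 2 := by
        rw [← Real.rpow_natCast, ← Real.rpow_mul hℓ0.le]; congr 1; push_cast; ring
      set y := ℓ ^ (s / 2)
      set Z := C2 * η ^ (-q) with hZ
      have h3 : Z * y ≤ δ / 4 * y ^ 2 + Z ^ 2 / δ := by
        have : δ / 4 * y ^ 2 + Z ^ 2 / δ - Z * y = (δ * y / 2 - Z) ^ 2 / δ := by
          field_simp; ring
        have h4 : 0 ≤ (δ * y / 2 - Z) ^ 2 / δ := by positivity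
        linarith
      have h5 : C2 * (η ^ (-q) * y) = Z * y := by rw [hZ]; ring
      rw [h5] at h2
      rw [hy] at h2 ⊢
      linarith
  have hbig : Q ≤ ℓ ^ s + (d:ℝ) ^ t := by
    have hdt : 0 < (d:ℝ) ^ t := by positivity
    have hor : max (Q ^ (1 / t)) (Real.exp (Q ^ (1 / s))) ≤ ε⁻¹ ∨
        max (Q ^ (1 / t)) (Real.exp (Q ^ (1 / s))) ≤ d := by
      by_contra hcon
      push Not at hcon
      linarith [hcon.1, hcon.2]
    rcases hor with h1 | h1
    · have h2 := (le_max_right _ _).trans h1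
      have h3 : Q ^ (1 / s) ≤ Real.log ε⁻¹ := (Real.le_log_iff_exp_le (by positivity)).mpr h2
      have h4 : Q ^ (1 / s) ≤ ℓ := by linarith
      have h5 := Real.rpow_le_rpow (by positivity) h4 hs0.le
      rw [← Real.rpow_mul hQ0.le, one_div_mul_cancel hs0.ne', Real.rpow_one] at h5
      linarith
    · have h2 := (le_max_left _ _).trans h1
      have h5 := Real.rpow_le_rpow (by positivity) h2 ht0.le
      rw [← Real.rpow_mul hQ0.le, one_div_mul_cancel ht0.ne', Real.rpow_one] at h5
      linarith
  have hdt : 0 < (d:ℝ) ^ t := by positivity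
  have hden : 0 < ℓ ^ s + (d:ℝ) ^ t := by positivity
  rw [abs_of_nonneg (div_nonneg (Real.log_natCast_nonneg _) hden.le), div_lt_iff₀ hden]
  have h1 : C3 < δ / 4 * (ℓ ^ s + (d:ℝ) ^ t) := by
    have : δ / 4 * Q = C3 + δ / 4 := by rw [hQ]; field_simp
    have h2 := mul_le_mul_of_nonneg_left hbig (show 0 ≤ δ / 4 by positivity)
    linarith
  nlinarith [mul_pos hδ hdt]

set_option maxHeartbeats 2000000 in
lemma nec (w : ℝ) (hw : w ∈ Set.Ioo (0:ℝ) 1) (a b : ℕ → ℝ)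
    (a1 : ℝ) (ha1 : 0 < a1) (ha1' : ∀ j, 1 ≤ j → a1 ≤ a j)
    (hmono : ∀ d j, j < d → a (j + 1) ≤ a d)
    (c : ℝ) (hc : 0 < c) (hb : ∀ j, 1 ≤ j → c ≤ b j)
    (crit : Crit) (useStd : Bool)
    (s t : ℝ) (hs0 : 0 < s) (hs1 : s < 1) (ht1 : t ≤ 1)
    (h : EXPWTst s t (expKorNC w a b useStd crit)) :
    Filter.Tendsto (fun j : ℕ => a j / (j : ℝ) ^ ((1 - s) / s)) Filter.atTop Filter.atTop := by
  have hL := L_pos hw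
  have ha : ∀ j, 1 ≤ j → 0 < a j := fun j hj => ha1.trans_le (ha1' j hj)
  have hb0 : ∀ j, 1 ≤ j → b j ≠ 0 := fun j hj => (hc.trans_le (hb j hj)).ne'
  obtain ⟨C, hC0, hC⟩ := one_dim c 1 hc one_pos
  set L := -Real.log w with hLd
  set B := C * (L / 8 * a1) ^ (-(1:ℝ)) with hB
  have hB0 : 0 ≤ B := by positivity
  have hM : ∀ d, ∀ A : Finset (Fin d → ℤ), ∑ h ∈ A, Real.exp (-(L / 8 * EE a b d h)) ≤ Real.exp (B * d) := by
    intro d A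
    refine (EE_sum a b C 1 c ha hb hC d (L / 8) (by positivity) A).trans (Real.exp_le_exp.mpr ?_)
    rw [hB, mul_assoc]
    gcongr
    calc _ ≤ ∑ j ∈ Finset.range d, (L / 8 * a1) ^ (-(1:ℝ)) := by
          refine Finset.sum_le_sum fun j _ => (min_le_left _ _).trans ?_
          apply Real.rpow_le_rpow_of_nonpos (by positivity) _ (by norm_num)
          gcongr
          exact ha1' _ (by omega)
      _ = _ := by simp [mul_comm]
  by_contra hnot
  rw [Filter.tendsto_atTop] at hnot
  push Not at hnot
  obtain ⟨K0, hK0⟩ := hnot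
  set K := max K0 0 with hK
  have hK00 : 0 ≤ K := le_max_right _ _
  set Γ := B + L * K / 2 + 1 with hΓ
  have hΓ0 : 0 < Γ := by positivity
  have hG : 0 < (1 + Γ) ^ s := by positivity
  obtain ⟨M0, hM0⟩ := h (Real.log 2 / ((1 + Γ) ^ s + 1)) (by
    have := Real.log_pos one_lt_two
    positivity)
  obtain ⟨d, hd1, hd2⟩ := (hK0.and_eventually (Filter.eventually_ge_atTop (max 1 ⌈M0⌉₊))).exists
  have hd : 1 ≤ d := (le_max_left _ _).trans hd2
  have hdM : M0 ≤ d := (Nat.le_ceil M0).trans (by exact_mod_cast (le_max_right _ _).trans hd2)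
  have hdR : (1:ℝ) ≤ d := by exact_mod_cast hd
  have hd0 : (0:ℝ) < d := by linarith
  set D := (d:ℝ) ^ (1 / s) with hD
  have hs1' : 1 ≤ 1 / s := by rw [le_div_iff₀ hs0]; linarith
  have hdD : (d:ℝ) ≤ D := by
    have := Real.rpow_le_rpow_of_exponent_le hdR hs1'
    rwa [Real.rpow_one] at this
  have hD0 : 0 < D := by linarith
  have had : d * a d ≤ K * D := by
    have h1 : a d / (d:ℝ) ^ ((1 - s) / s) ≤ K := (not_le.mp (by simpa using hd1)).le.trans (le_max_left _ _)
    rw [div_le_iff₀ (by positivity)] at h1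
    have h2 : D = (d:ℝ) ^ ((1 - s) / s) * d := by
      rw [← Real.rpow_add_one hd0.ne', hD]; congr 1; field_simp; ring
    rw [h2]
    nlinarith
  set ε := Real.exp (-(Γ * D)) with hε
  have hε1 : ε ∈ Set.Ioo (0:ℝ) 1 := by
    refine ⟨Real.exp_pos _, ?_⟩
    rw [hε, ← Real.exp_zero]
    apply Real.exp_lt_exp.mpr
    have : 0 < Γ * D := by positivity
    linarith
  have hlog2 : Real.log 2 < 1 := by linarith [Real.log_two_lt_d9]
  have hlog2' : 0 < Real.log 2 := Real.log_pos one_lt_two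
  have hlow := lower_le hw ha (Real.one_le_exp (by positivity : 0 ≤ B * d)) (hM d) hb0 (hmono d) crit useStd ε hε1 (by
    have h2 : (2:ℝ) ^ d = Real.exp (d * Real.log 2) := by
      rw [Real.exp_nat_mul, Real.exp_log two_pos]
    rw [h2, ← Real.exp_sub, hε, ← Real.exp_add]
    apply Real.exp_lt_exp.mpr
    rw [hΓ, ← hLd]
    have h3 := mul_le_mul_of_nonneg_left had hL.le
    have h4 := mul_le_mul_of_nonneg_left hdD hB0
    have h5 : d * Real.log 2 < D := by nlinarith
    nlinarith)
  have hfin := hM0 d hd ε hε1 (by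
    have : 0 < ε⁻¹ := inv_pos.mpr hε1.1
    linarith)
  have hlogε : Real.log ε⁻¹ = Γ * D := by rw [Real.log_inv, hε, Real.log_exp, neg_neg]
  simp only [hlogε] at hfin
  set n := expKorNC w a b useStd crit d ε
  have hn : d * Real.log 2 ≤ Real.log n := by
    rw [← Real.log_pow]
    apply Real.log_le_log (by positivity)
    exact_mod_cast hlow
  have hGD : 0 < 1 + Γ * D := by positivity
  have hden0 : 0 < (1 + Γ * D) ^ s + (d:ℝ) ^ t := by positivity
  have hden : (1 + Γ * D) ^ s + (d:ℝ) ^ t ≤ ((1 + Γ) ^ s + 1) * d := by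
    have h1 : (1 + Γ * D) ^ s ≤ ((1 + Γ) * D) ^ s := by
      apply Real.rpow_le_rpow hGD.le _ hs0.le
      nlinarith
    rw [Real.mul_rpow (by positivity) hD0.le, hD, ← Real.rpow_mul hd0.le, one_div_mul_cancel hs0.ne', Real.rpow_one] at h1
    have h2 : (d:ℝ) ^ t ≤ d := by
      have := Real.rpow_le_rpow_of_exponent_le hdR ht1
      rwa [Real.rpow_one] at this
    rw [← hD] at h1
    linarith
  rw [abs_of_nonneg (div_nonneg (Real.log_natCast_nonneg _) hden0.le), div_lt_iff₀ hden0] at hfin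
  have h3 : Real.log 2 / ((1 + Γ) ^ s + 1) * ((1 + Γ * D) ^ s + (d:ℝ) ^ t) ≤ Real.log 2 / ((1 + Γ) ^ s + 1) * (((1 + Γ) ^ s + 1) * d) := by
    gcongr
  have h4 : Real.log 2 / ((1 + Γ) ^ s + 1) * (((1 + Γ) ^ s + 1) * d) = d * Real.log 2 := by
    field_simp
  linarith

/-- For the Korobov spaces with exponential weight, for either
information class and either error criterion, and `0 < s < 1`, `0 < t ≤ 1`:
EXP-`(s,t)`-WT ⟺ `lim_j a_j / j^{(1-s)/s} = ∞`. -/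
theorem stmt19
    (w : ℝ) (hw : w ∈ Set.Ioo (0:ℝ) 1)
    (a b : ℕ → ℝ)
    (hapos : 0 < a 1) (hamono : ∀ j, 1 ≤ j → a j ≤ a (j + 1))
    (hb : ∃ c > (0:ℝ), ∀ j, 1 ≤ j → c ≤ b j)
    (crit : Crit) (useStd : Bool)
    (s t : ℝ) (hs0 : 0 < s) (hs1 : s < 1) (ht0 : 0 < t) (ht1 : t ≤ 1) :
    EXPWTst s t (expKorNC w a b useStd crit) ↔
      Filter.Tendsto (fun j : ℕ => a j / (j : ℝ) ^ ((1 - s) / s))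
        Filter.atTop Filter.atTop := by
  obtain ⟨c, hc, hb⟩ := hb
  have hmono : ∀ i j, 1 ≤ i → i ≤ j → a i ≤ a j := by
    intro i j hi hij
    induction j, hij using Nat.le_induction with
    | base => exact le_rfl
    | succ j hj ih => exact ih.trans (hamono j (hi.trans hj))
  constructor
  · exact nec w hw a b (a 1) hapos (fun j hj => hmono 1 j le_rfl hj)
      (fun d j hj => hmono (j + 1) d (by omega) (by omega)) c hc hb crit useStd s t hs0 hs1 ht1
  · exact suff w hw a b (a 1) hapos (fun j hj => hmono 1 j le_rfl hj) c hc hb crit useStd s t hs0 hs1 ht0
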